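/- arXiv:math/0312136 — 2 statements merged into one kernel-verified Lean document; each statement's English description precedes it below -/
import Mathlib

section
/- Let F be a cellular automaton with radius r on a closed σ-invariant set X ⊆ A^ℤ, and let B ∈ A^{2k+1} be a blocking word for F. Then every point x ∈ X whose sequence of coordinates contains infinitely many occurrences of B among the positive coordinates and infinitely many occurrences of B among the negative coordinates is an equicontinuous point of F. -/
open MeasureTheory Filter Topology Set

noncomputable section

/-- The shift map `σ` on `ℤ → A`, defined by `(σ x) i = x (i + 1)`. -/
def shiftMap (A : Type*) : (ℤ → A) → (ℤ → A) := fun x i => x (i + 1)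

/-- The iterate `σ^j` of the shift, for `j : ℤ`: `(σ^j x) i = x (i + j)`. -/
def shiftIter {A : Type*} (j : ℤ) (x : ℤ → A) : ℤ → A := fun i => x (i + j)

/-- `F` admits a local rule of radius `r`:
`F(x)_i = f (x_{i-r}, …, x_{i+r})` for a block map `f : A^{2r+1} → A`. -/
def HasLocalRule {A : Type*} (F : (ℤ → A) → (ℤ → A)) (r : ℕ) : Prop :=
  ∃ f : (Fin (2 * r + 1) → A) → A, ∀ (x : ℤ → A) (i : ℤ),
    F x i = f fun j => x (i - (r : ℤ) + ((j : ℕ) : ℤ))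

/-- `W_s⁺(x) = {y ∈ X : y_i = x_i for all i ≥ s}`. -/
def Wplus {A : Type*} (X : Set (ℤ → A)) (s : ℤ) (x : ℤ → A) : Set (ℤ → A) :=
  {y ∈ X | ∀ i : ℤ, s ≤ i → y i = x i}

/-- `W_s⁻(x) = {y ∈ X : y_i = x_i for all i ≤ s}`. -/
def Wminus {A : Type*} (X : Set (ℤ → A)) (s : ℤ) (x : ℤ → A) : Set (ℤ → A) :=
  {y ∈ X | ∀ i : ℤ, i ≤ s → y i = x i}

/-- `Λ̃ₙ⁺(x) = min{s ≥ 0 : F^i(W₀⁺(x)) ⊆ W_s⁺(F^i(x)) for all 1 ≤ i ≤ n}`. -/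
def lamTildeP {A : Type*} (X : Set (ℤ → A)) (F : (ℤ → A) → (ℤ → A)) (n : ℕ)
    (x : ℤ → A) : ℕ :=
  sInf {s : ℕ | ∀ i : ℕ, 1 ≤ i → i ≤ n →
    F^[i] '' Wplus X 0 x ⊆ Wplus X (s : ℤ) (F^[i] x)}

/-- `Λ̃ₙ⁻(x) = min{s ≥ 0 : F^i(W₀⁻(x)) ⊆ W_{-s}⁻(F^i(x)) for all 1 ≤ i ≤ n}`. -/
def lamTildeM {A : Type*} (X : Set (ℤ → A)) (F : (ℤ → A) → (ℤ → A)) (n : ℕ)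
    (x : ℤ → A) : ℕ :=
  sInf {s : ℕ | ∀ i : ℕ, 1 ≤ i → i ≤ n →
    F^[i] '' Wminus X 0 x ⊆ Wminus X (-(s : ℤ)) (F^[i] x)}

/-- `Λₙ⁺(x) = max_{j ∈ ℤ} Λ̃ₙ⁺(σ^j x)`. -/
def lamP {A : Type*} (X : Set (ℤ → A)) (F : (ℤ → A) → (ℤ → A)) (n : ℕ)
    (x : ℤ → A) : ℕ :=
  sSup (Set.range fun j : ℤ => lamTildeP X F n (shiftIter j x))

/-- `Λₙ⁻(x) = max_{j ∈ ℤ} Λ̃ₙ⁻(σ^j x)`. -/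
def lamM {A : Type*} (X : Set (ℤ → A)) (F : (ℤ → A) → (ℤ → A)) (n : ℕ)
    (x : ℤ → A) : ℕ :=
  sSup (Set.range fun j : ℤ => lamTildeM X F n (shiftIter j x))

/-- `Iₙ⁺(x) = min{s ≥ 0 : F^i(W_{-s}⁺(x)) ⊆ W₀⁺(F^i(x)) for all 1 ≤ i ≤ n}`. -/
def Iplus {A : Type*} (X : Set (ℤ → A)) (F : (ℤ → A) → (ℤ → A)) (n : ℕ)
    (x : ℤ → A) : ℕ :=
  sInf {s : ℕ | ∀ i : ℕ, 1 ≤ i → i ≤ n →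
    F^[i] '' Wplus X (-(s : ℤ)) x ⊆ Wplus X 0 (F^[i] x)}

/-- `Iₙ⁻(x) = min{s ≥ 0 : F^i(W_s⁻(x)) ⊆ W₀⁻(F^i(x)) for all 1 ≤ i ≤ n}`. -/
def Iminus {A : Type*} (X : Set (ℤ → A)) (F : (ℤ → A) → (ℤ → A)) (n : ℕ)
    (x : ℤ → A) : ℕ :=
  sInf {s : ℕ | ∀ i : ℕ, 1 ≤ i → i ≤ n →
    F^[i] '' Wminus X (s : ℤ) x ⊆ Wminus X 0 (F^[i] x)}

/-- Average Lyapunov exponent `I_μ⁺ = liminf_n (∫ Iₙ⁺ dμ) / n`. -/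
def avgIplus {A : Type*} [MeasurableSpace A] (X : Set (ℤ → A))
    (F : (ℤ → A) → (ℤ → A)) (μ : Measure (ℤ → A)) : ℝ :=
  Filter.liminf (fun n : ℕ => (∫ x, (Iplus X F n x : ℝ) ∂μ) / n) Filter.atTop

/-- Average Lyapunov exponent `I_μ⁻ = liminf_n (∫ Iₙ⁻ dμ) / n`. -/
def avgIminus {A : Type*} [MeasurableSpace A] (X : Set (ℤ → A))
    (F : (ℤ → A) → (ℤ → A)) (μ : Measure (ℤ → A)) : ℝ :=
  Filter.liminf (fun n : ℕ => (∫ x, (Iminus X F n x : ℝ) ∂μ) / n) Filter.atTop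

/-- The topological support `S(μ)` of a measure `μ` on `ℤ → A`. -/
def msupp {A : Type*} [TopologicalSpace A] [MeasurableSpace A]
    (μ : Measure (ℤ → A)) : Set (ℤ → A) :=
  {x | ∀ U : Set (ℤ → A), IsOpen U → x ∈ U → 0 < μ U}

/-- `x` is an equicontinuous point of `F` on `X`: for every `ε = 2^{-m}` there is a
`δ = 2^{-k}` such that points of `X` agreeing with `x` on coordinates `|j| ≤ k`
have all their `F`-iterates agreeing with those of `x` on coordinates `|j| ≤ m`. -/
def IsEquicontPt {A : Type*} (X : Set (ℤ → A)) (F : (ℤ → A) → (ℤ → A))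
    (x : ℤ → A) : Prop :=
  ∀ m : ℕ, ∃ k : ℕ, ∀ y ∈ X, (∀ j : ℤ, |j| ≤ (k : ℤ) → y j = x j) →
    ∀ n : ℕ, ∀ j : ℤ, |j| ≤ (m : ℤ) → F^[n] y j = F^[n] x j

/-- Entropy `H_μ(α) = ∑ -μ(A) log μ(A)` of the finite partition given by the
fibers of `α`. -/
def partEnt {Ω : Type*} [MeasurableSpace Ω] (μ : Measure Ω) {I : Type*} [Fintype I]
    (α : Ω → I) : ℝ :=
  ∑ i : I, Real.negMulLog (μ (α ⁻¹' {i})).toReal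

/-- Metric entropy `h_μ(T, α)` of `T` relative to the finite partition `α`
(the limit of the subadditive sequence `H_μ(α ∨ T⁻¹α ∨ … ∨ T^{-n}α)/(n+1)`
equals its infimum). -/
def entropyPart {Ω : Type*} [MeasurableSpace Ω] (μ : Measure Ω) (T : Ω → Ω)
    {k : ℕ} (α : Ω → Fin k) : ℝ :=
  ⨅ n : ℕ, partEnt μ (fun x (i : Fin (n + 1)) => α (T^[(i : ℕ)] x)) / (n + 1)

/-- Kolmogorov–Sinai metric entropy `h_μ(T)`: supremum of `h_μ(T, α)` over all
finite measurable partitions `α`. -/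
def metricEntropy {Ω : Type*} [MeasurableSpace Ω] (μ : Measure Ω) (T : Ω → Ω) : ℝ :=
  ⨆ p : {q : Σ k : ℕ, Ω → Fin k // Measurable q.2}, entropyPart μ T p.1.2

/-- `B ∈ A^{2k+1}` is a blocking word for `F` (with radius `r`): there are `i` with
`2i+1 ≥ r` and words `vₙ ∈ A^{2i+1}`, independent of `x`, such that every `x ∈ X`
with `x(-k,k) = B` satisfies `F^n(x)(-i,i) = vₙ` for all `n ≥ 1`. -/
def IsBlockingWord {A : Type*} (X : Set (ℤ → A)) (F : (ℤ → A) → (ℤ → A)) (r k : ℕ)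
    (B : Fin (2 * k + 1) → A) : Prop :=
  ∃ i : ℕ, r ≤ 2 * i + 1 ∧ ∃ v : ℕ → Fin (2 * i + 1) → A,
    ∀ x ∈ X, (∀ j : Fin (2 * k + 1), x (((j : ℕ) : ℤ) - (k : ℤ)) = B j) →
      ∀ n : ℕ, 1 ≤ n → ∀ j : Fin (2 * i + 1),
        F^[n] x (((j : ℕ) : ℤ) - (i : ℤ)) = v n j

/-- `D(n, 2^{-p})`: minimal cardinality of an `(n, 2^{-p})`-covering (spanning) set
for `F`, where closeness in the Bowen metric `d_n` up to `2^{-p}` means agreement of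
all iterates `F^i`, `i ≤ n`, on the coordinates `|j| ≤ p`. -/
def coverNum {A : Type*} (F : (ℤ → A) → (ℤ → A)) (n p : ℕ) : ℕ :=
  sInf {N : ℕ | ∃ S : Finset (ℤ → A), S.card ≤ N ∧ ∀ x : ℤ → A, ∃ y ∈ S,
    ∀ i : ℕ, i ≤ n → ∀ j : ℤ, |j| ≤ (p : ℤ) → F^[i] x j = F^[i] y j}

/-- Topological entropy `h_top(F) = lim_{ε→0} lim_n (1/n) log D(n, ε)`. -/
def htop {A : Type*} (F : (ℤ → A) → (ℤ → A)) : ℝ :=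
  ⨆ p : ℕ, Filter.limsup (fun n : ℕ => Real.log (coverNum F n p) / n) Filter.atTop

end

theorem HasLocalRule.iterate_shiftIter {A : Type*} {F : (ℤ → A) → (ℤ → A)} {r : ℕ}
    (hloc : HasLocalRule F r) (t : ℤ) (n : ℕ) (x : ℤ → A) :
    F^[n] (shiftIter t x) = shiftIter t (F^[n] x) := by
  obtain ⟨f, hf⟩ := hloc
  have hcomm : Function.Commute F (shiftIter t) := by
    intro z
    funext i
    simp only [shiftIter, hf]
    congr 1
    funext j
    congr 1
    ring
  exact (hcomm.iterate_left n) x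

theorem HasLocalRule.apply_congr {A : Type*} {F : (ℤ → A) → (ℤ → A)} {r : ℕ}
    (hloc : HasLocalRule F r) {x y : ℤ → A} {i : ℤ}
    (h : ∀ j : ℤ, i - r ≤ j → j ≤ i + r → y j = x j) : F y i = F x i := by
  obtain ⟨f, hf⟩ := hloc
  rw [hf, hf]
  congr 1
  funext j
  exact h _ (by omega) (by omega)

theorem shiftIter_mem {A : Type*} {X : Set (ℤ → A)} (hX : shiftMap A '' X = X)
    {x : ℤ → A} (hx : x ∈ X) (t : ℤ) : shiftIter t x ∈ X := by
  induction t using Int.induction_on with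
  | zero =>
    convert hx using 1
    funext i
    simp [shiftIter]
  | succ t ih =>
    rw [← hX]
    refine ⟨_, ih, ?_⟩
    funext i
    simp only [shiftMap, shiftIter]
    congr 1
    ring
  | pred t ih =>
    rw [← hX] at ih
    obtain ⟨z, hz, hzx⟩ := ih
    convert hz using 1
    funext i
    have h := congrFun hzx (i - 1)
    simp only [shiftMap, shiftIter, sub_add_cancel] at h
    rw [h, shiftIter]
    congr 1
    ring

/-- Two points of `X` sharing an occurrence of a blocking word at position `t` have equal
iterates on the window that the word controls. -/
theorem IsBlockingWord.exists_window {A : Type*} {X : Set (ℤ → A)} {F : (ℤ → A) → (ℤ → A)}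
    {r k : ℕ} {B : Fin (2 * k + 1) → A} (hB : IsBlockingWord X F r k B)
    (hX : shiftMap A '' X = X) (hloc : HasLocalRule F r) :
    ∃ i : ℕ, r ≤ 2 * i + 1 ∧ ∀ x ∈ X, ∀ y ∈ X, ∀ t : ℤ,
      (∀ j : Fin (2 * k + 1), x (t + ((j : ℕ) : ℤ)) = B j) →
      (∀ j : Fin (2 * k + 1), y (t + ((j : ℕ) : ℤ)) = B j) →
      ∀ n : ℕ, 1 ≤ n → ∀ j : ℤ, t + k - i ≤ j → j ≤ t + k + i →
        F^[n] y j = F^[n] x j := by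
  obtain ⟨i, hri, v, hv⟩ := hB
  refine ⟨i, hri, fun x hx y hy t hxt hyt n hn j hj₁ hj₂ => ?_⟩
  have key : ∀ z ∈ X, (∀ j : Fin (2 * k + 1), z (t + ((j : ℕ) : ℤ)) = B j) →
      F^[n] z j = v n ⟨(j - (t + k - i)).toNat, by omega⟩ := by
    intro z hz hzt
    rw [← hv _ (shiftIter_mem hX hz (t + k)) (fun l => ?_) n hn, hloc.iterate_shiftIter]
    · have hcoord : (((j - (t + k - i)).toNat : ℕ) : ℤ) - i + (t + k) = j := by omega
      simp only [shiftIter, hcoord]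
    · rw [← hzt l, shiftIter]
      congr 1
      ring
  rw [key x hx hxt, key y hy hyt]

/-- Any point of `X` containing infinitely many occurrences of a blocking word `B`
among its positive coordinates and among its negative coordinates is an
equicontinuous point of `F`. -/
theorem stmt14 {A : Type*} [Fintype A] [TopologicalSpace A] [DiscreteTopology A]
    (X : Set (ℤ → A)) (hXcl : IsClosed X) (hXσ : shiftMap A '' X = X)
    (F : (ℤ → A) → (ℤ → A)) (hFX : Set.MapsTo F X X) (hFc : Continuous F)
    (hFσ : ∀ x, F (shiftMap A x) = shiftMap A (F x))
    (r : ℕ) (hr : 1 ≤ r) (hloc : HasLocalRule F r)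
    (k : ℕ) (B : Fin (2 * k + 1) → A) (hB : IsBlockingWord X F r k B)
    (x : ℤ → A) (hx : x ∈ X)
    (hpos : ∀ N : ℤ, ∃ t : ℤ, N ≤ t ∧
      ∀ j : Fin (2 * k + 1), x (t + ((j : ℕ) : ℤ)) = B j)
    (hneg : ∀ N : ℤ, ∃ t : ℤ, t ≤ N ∧
      ∀ j : Fin (2 * k + 1), x (t + ((j : ℕ) : ℤ)) = B j) :
    IsEquicontPt X F x := by
  obtain ⟨i, hri, hwin⟩ := hB.exists_window hXσ hloc
  intro m
  obtain ⟨t₁, ht₁, hx₁⟩ := hneg (-m - k + i)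
  obtain ⟨t₂, ht₂, hx₂⟩ := hpos (m - k - i)
  refine ⟨t₁.natAbs + t₂.natAbs + 2 * k + i, fun y hy hyx => ?_⟩
  have hy₁ : ∀ j : Fin (2 * k + 1), y (t₁ + ((j : ℕ) : ℤ)) = B j := fun j => by
    rw [← hx₁ j]
    exact hyx _ (abs_le.2 (by omega))
  have hy₂ : ∀ j : Fin (2 * k + 1), y (t₂ + ((j : ℕ) : ℤ)) = B j := fun j => by
    rw [← hx₂ j]
    exact hyx _ (abs_le.2 (by omega))
  have main : ∀ n : ℕ, ∀ j : ℤ, t₁ + k - i ≤ j → j ≤ t₂ + k + i →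
      F^[n] y j = F^[n] x j := by
    intro n
    induction n with
    | zero => exact fun j hj₁ hj₂ => hyx j (abs_le.2 (by omega))
    | succ n ih =>
      intro j hj₁ hj₂
      by_cases hleft : j ≤ t₁ + k + i
      · exact hwin x hx y hy t₁ hx₁ hy₁ _ n.succ_pos j hj₁ hleft
      by_cases hright : t₂ + k - i ≤ j
      · exact hwin x hx y hy t₂ hx₂ hy₂ _ n.succ_pos j hright hj₂
      rw [Function.iterate_succ_apply', Function.iterate_succ_apply']
      exact hloc.apply_congr fun l hl₁ hl₂ => ih l (by omega) (by omega)
  intro n j hj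
  rw [abs_le] at hj
  exact main n j (by omega) (by omega)
end

section
/- Let F be the Coven cellular automaton on {0,1}^ℤ with radius 2 and local rule F(x)_i = x_i + 1 (mod 2) if (x_{i+1}, x_{i+2}) = (1,0), and F(x)_i = x_i otherwise, and let μ be the uniform Bernoulli measure on {0,1}^ℤ. Then the Lyapunov exponents of F with respect to μ satisfy λ_μ⁺ = 0 and λ_μ⁻ = 2, while the average Lyapunov exponents satisfy I_μ⁺ + I_μ⁻ = 0 and the metric entropy satisfies h_μ(F) = 0. -/
open MeasureTheory Filter Topology Set

/-- The Coven cellular automaton of radius 2 with aperiodic word `10`: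
`F(x)_i = x_i + 1 (mod 2)` if `(x_{i+1}, x_{i+2}) = (1, 0)`, and
`F(x)_i = x_i` otherwise. -/
def covenF : (ℤ → Fin 2) → (ℤ → Fin 2) := fun x i =>
  if x (i + 1) = 1 ∧ x (i + 2) = 0 then x i + 1 else x i

theorem covenF_iterate_eqOn_ge {x y : ℤ → Fin 2} {a : ℤ} (h : ∀ i, a ≤ i → y i = x i) (n : ℕ) :
    ∀ i, a ≤ i → covenF^[n] y i = covenF^[n] x i := by
  induction n with
  | zero => simpa using h
  | succ n ih =>
    intro i hi
    rw [Function.iterate_succ_apply', Function.iterate_succ_apply']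
    simp only [covenF]
    rw [ih i hi, ih (i + 1) (by lia), ih (i + 2) (by lia)]

theorem covenF_iterate_eqOn_le {x y : ℤ → Fin 2} {a : ℤ} (h : ∀ i, i ≤ a → y i = x i) (n : ℕ) :
    ∀ i, i ≤ a - 2 * n → covenF^[n] y i = covenF^[n] x i := by
  induction n with
  | zero => simpa using h
  | succ n ih =>
    intro i hi
    push_cast at hi
    rw [Function.iterate_succ_apply', Function.iterate_succ_apply']
    simp only [covenF]
    rw [ih i (by lia), ih (i + 1) (by lia), ih (i + 2) (by lia)]

/-- `x` vanishes at `q` and `q + 1`, and the run of ones starting at `q + 2` is infinite or of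
even length. -/
def HasEvenRun (x : ℤ → Fin 2) (q : ℤ) : Prop :=
  x q = 0 ∧ x (q + 1) = 0 ∧
    ∀ k : ℕ, (∀ j : ℕ, j < 2 * k + 1 → x (q + 2 + j) = 1) → x (q + 2 + (2 * k + 1 : ℕ)) = 1

theorem fin_two_add_one_eq_one_iff (a : Fin 2) : a + 1 = 1 ↔ a = 0 := by
  revert a; decide

theorem fin_two_ne_one_iff (a : Fin 2) : a ≠ 1 ↔ a = 0 := by
  revert a; decide

theorem covenF_eq_one_iff (x : ℤ → Fin 2) (i : ℤ) :
    covenF x i = 1 ↔ (x i = 0 ↔ x (i + 1) = 1 ∧ x (i + 2) = 0) := by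
  have h := fin_two_add_one_eq_one_iff (x i)
  have h' := fin_two_ne_one_iff (x i)
  unfold covenF
  split_ifs <;> tauto

theorem covenF_eq_one_iff_cast (x : ℤ → Fin 2) (q : ℤ) (m : ℕ) :
    covenF x (q + 2 + m) = 1 ↔
      (x (q + 2 + m) = 0 ↔ x (q + 2 + (m + 1 : ℕ)) = 1 ∧ x (q + 2 + (m + 2 : ℕ)) = 0) := by
  rw [covenF_eq_one_iff]
  push_cast
  simp only [add_assoc]

theorem HasEvenRun.covenF {x : ℤ → Fin 2} {q : ℤ} (h : HasEvenRun x q) :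
    HasEvenRun (covenF x) q := by
  obtain ⟨h0, h1, h2⟩ := h
  have hz (i : ℤ) := fin_two_ne_one_iff (x i)
  refine ⟨?_, ?_, fun k hk => ?_⟩
  · simp [_root_.covenF, h0, h1]
  · have h3 : ¬ (x (q + 1 + 1) = 1 ∧ x (q + 1 + 2) = 0) := by
      rintro ⟨ha, hb⟩
      have := h2 0 (fun j hj => by
        obtain rfl : j = 0 := by lia
        rw [← ha]; congr 1; push_cast; ring)
      rw [show q + 2 + ((2 * 0 + 1 : ℕ) : ℤ) = q + 1 + 2 by push_cast; ring, hb] at this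
      exact absurd this (by decide)
    simp [_root_.covenF, h1, h3]
  · simp only [covenF_eq_one_iff_cast] at hk ⊢
    have key : ∀ f : ℕ → Fin 2, (∀ i, f i ≠ 1 ↔ f i = 0) →
        (∀ k : ℕ, (∀ j : ℕ, j < 2 * k + 1 → f j = 1) → f (2 * k + 1) = 1) →
        (∀ j < 2 * k + 1, (f j = 0 ↔ f (j + 1) = 1 ∧ f (j + 2) = 0)) →
        (f (2 * k + 1) = 0 ↔ f (2 * k + 1 + 1) = 1 ∧ f (2 * k + 1 + 2) = 0) := by
      intro f hf h2 hk
      by_cases hx : f 0 = 1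
      · have hrun : ∀ m ≤ k, ∀ j < 2 * m + 2, f j = 1 := by
          intro m
          induction m with
          | zero =>
            intro _ j hj
            have := h2 0 (fun j hj => by obtain rfl : j = 0 := by lia
                                         exact hx)
            interval_cases j <;> simpa
          | succ m ih =>
            intro hm
            have ih := ih (by lia)
            have e := hk (2 * m) (by lia)
            have e1 := ih (2 * m) (by lia)
            have e2 := ih (2 * m + 1) (by lia)
            have e3 := hf (2 * m)
            have e4 := hf (2 * m + 2)
            have e5 : f (2 * m + 2) = 1 := by tauto
            have e6 : ∀ j < 2 * (m + 1) + 1, f j = 1 := fun j hj => by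
              rcases Nat.lt_succ_iff_lt_or_eq.1 hj with h | h
              · exact ih j (by lia)
              · rw [h]; exact e5
            have e7 := h2 (m + 1) e6
            intro j hj
            rcases Nat.lt_succ_iff_lt_or_eq.1 hj with h | h
            · exact e6 j (by lia)
            · rw [h]; exact e7
        have ih := hrun k le_rfl
        have e := hk (2 * k) (by lia)
        have e1 := ih (2 * k) (by lia)
        have e2 := ih (2 * k + 1) (by lia)
        have e3 := hf (2 * k)
        have e3' := hf (2 * k + 1)
        have e4 := hf (2 * k + 2)
        have e5 : f (2 * k + 2) = 1 := by tauto
        have e7 := h2 (k + 1) fun j hj => by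
          rcases Nat.lt_succ_iff_lt_or_eq.1 hj with h | h
          · exact ih j (by lia)
          · rw [h]; exact e5
        have e8 := hf (2 * k + 3)
        rw [show 2 * (k + 1) + 1 = 2 * k + 3 by ring] at e7
        rw [show 2 * k + 1 + 2 = 2 * k + 3 by ring]
        tauto
      · have hrun : ∀ m ≤ k, f (2 * m) = 0 := by
          intro m
          induction m with
          | zero => exact fun _ => (hf 0).1 hx
          | succ m ih => exact fun hm => ((hk (2 * m) (by lia)).1 (ih (by lia))).2
        have e := (hk (2 * k) (by lia)).1 (hrun k le_rfl)
        have e1 := hf (2 * k + 1)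
        have e2 := hf (2 * k + 2)
        rw [show 2 * k + 1 + 1 = 2 * k + 2 by ring]
        tauto
    exact key (fun j => x (q + 2 + j)) (fun i => hz _) h2 hk

theorem covenF_iterate_eq_zero {x : ℤ → Fin 2} {q : ℤ}
    (h : ∀ j : Fin 3, x (q + ((j : ℕ) : ℤ)) = 0) (n : ℕ) :
    covenF^[n] x q = 0 ∧ covenF^[n] x (q + 1) = 0 := by
  have H : HasEvenRun (covenF^[n] x) q := by
    induction n with
    | zero =>
      refine ⟨by simpa using h 0, by simpa using h 1, fun k hk => ?_⟩
      have h2 : x (q + 2) = 0 := by simpa using h 2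
      have := hk 0 (by lia)
      simp [h2] at this
    | succ n ih =>
      rw [Function.iterate_succ_apply']
      exact ih.covenF
  exact ⟨H.1, H.2.1⟩

theorem covenF_iterate_eqOn_of_zeros {x y : ℤ → Fin 2} {q : ℤ}
    (hx : ∀ j : Fin 3, x (q + ((j : ℕ) : ℤ)) = 0) (h : ∀ i, i ≤ q + 2 → y i = x i) (n : ℕ) :
    ∀ i, i ≤ q + 1 → covenF^[n] y i = covenF^[n] x i := by
  have hy : ∀ j : Fin 3, y (q + ((j : ℕ) : ℤ)) = 0 := fun j => by
    rw [h _ (by have := j.isLt; lia), hx]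
  induction n with
  | zero => exact fun i hi => h i (by lia)
  | succ n ih =>
    intro i hi
    rcases lt_or_ge i q with hiq | hiq
    · rw [Function.iterate_succ_apply', Function.iterate_succ_apply']
      simp only [covenF]
      rw [ih i (by lia), ih (i + 1) (by lia), ih (i + 2) (by lia)]
    · have h1 := covenF_iterate_eq_zero hx (n + 1)
      have h2 := covenF_iterate_eq_zero hy (n + 1)
      obtain rfl | rfl : i = q ∨ i = q + 1 := by lia
      · rw [h1.1, h2.1]
      · rw [h1.2, h2.2]

theorem covenF_iterate_add_two_pow {x : ℤ → Fin 2} {q : ℤ}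
    (hx : ∀ j : Fin 3, x (q + ((j : ℕ) : ℤ)) = 0) (d : ℕ) :
    ∀ i, q - d ≤ i → i ≤ q + 1 → ∀ t : ℕ, covenF^[t + 2 ^ d] x i = covenF^[t] x i := by
  induction d with
  | zero =>
    intro i hi hi' t
    have h1 := covenF_iterate_eq_zero hx t
    have h2 := covenF_iterate_eq_zero hx (t + 2 ^ 0)
    obtain rfl | rfl : i = q ∨ i = q + 1 := by lia
    · rw [h1.1, h2.1]
    · rw [h1.2, h2.2]
  | succ d ih =>
    intro i hi hi' t
    have hpow : t + 2 ^ (d + 1) = t + 2 ^ d + 2 ^ d := by ring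
    rw [hpow]
    rcases le_or_gt (q - d) i with hid | hid
    · rw [ih i hid hi', ih i hid hi']
    · have hstep : ∀ t : ℕ, covenF^[t + 1 + 2 ^ d] x i - covenF^[t + 1] x i =
          covenF^[t + 2 ^ d] x i - covenF^[t] x i := by
        intro t
        rw [show t + 1 + 2 ^ d = t + 2 ^ d + 1 by ring, Function.iterate_succ_apply',
          Function.iterate_succ_apply']
        simp only [covenF]
        rw [ih (i + 1) (by lia) (by lia), ih (i + 2) (by lia) (by lia)]
        split_ifs
        · exact add_sub_add_right_eq_sub _ _ _
        · rfl
      have hconst : ∀ t : ℕ, covenF^[t + 2 ^ d] x i - covenF^[t] x i =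
          covenF^[0 + 2 ^ d] x i - covenF^[0] x i := by
        intro t
        induction t with
        | zero => rfl
        | succ t iht => rw [hstep, iht]
      have h1 := hconst t
      have h2 := hconst (t + 2 ^ d)
      have : ∀ a b c : Fin 2, a - b = b - c → a = c := by decide
      exact this _ _ _ (h2.trans h1.symm)

theorem lamP_covenF (n : ℕ) (x : ℤ → Fin 2) : lamP univ covenF n x = 0 := by
  have h (z : ℤ → Fin 2) : lamTildeP univ covenF n z = 0 := by
    refine Nat.sInf_eq_zero.2 (Or.inl fun i _ _ => ?_)
    rintro _ ⟨y, ⟨-, hy⟩, rfl⟩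
    exact ⟨mem_univ _, covenF_iterate_eqOn_ge hy i⟩
  simp [lamP, h]

theorem Iplus_covenF (n : ℕ) (x : ℤ → Fin 2) : Iplus univ covenF n x = 0 := by
  refine Nat.sInf_eq_zero.2 (Or.inl fun i _ _ => ?_)
  rintro _ ⟨y, ⟨-, hy⟩, rfl⟩
  exact ⟨mem_univ _, covenF_iterate_eqOn_ge (by simpa using hy) i⟩

theorem Iminus_covenF_le_two_mul (n : ℕ) (x : ℤ → Fin 2) : Iminus univ covenF n x ≤ 2 * n := by
  refine Nat.sInf_le fun i _ hi => ?_
  rintro _ ⟨y, ⟨-, hy⟩, rfl⟩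
  exact ⟨mem_univ _, fun j hj => covenF_iterate_eqOn_le hy i j (by push_cast; lia)⟩

theorem Iminus_covenF_le_of_zeros (n : ℕ) {x : ℤ → Fin 2} {q : ℕ}
    (hx : ∀ j : Fin 3, x (q + ((j : ℕ) : ℤ)) = 0) : Iminus univ covenF n x ≤ q + 2 := by
  refine Nat.sInf_le fun i _ hi => ?_
  rintro _ ⟨y, ⟨-, hy⟩, rfl⟩
  exact ⟨mem_univ _, fun j hj =>
    covenF_iterate_eqOn_of_zeros hx (by simpa using hy) i j (by lia)⟩

theorem mem_lamTildeM_covenF (n : ℕ) (x : ℤ → Fin 2) :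
    2 * n ∈ {s : ℕ | ∀ i : ℕ, 1 ≤ i → i ≤ n →
      covenF^[i] '' Wminus univ 0 x ⊆ Wminus univ (-(s : ℤ)) (covenF^[i] x)} := by
  intro i _ hi
  rintro _ ⟨y, ⟨-, hy⟩, rfl⟩
  exact ⟨mem_univ _, fun j hj => covenF_iterate_eqOn_le hy i j (by push_cast at hj; lia)⟩

theorem covenF_iterate_eq_one {x : ℤ → Fin 2} {a b : ℤ} (h : ∀ i, a ≤ i → i ≤ b → x i = 1)
    (n : ℕ) : ∀ i, a ≤ i → i ≤ b - 2 * n → covenF^[n] x i = 1 := by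
  induction n with
  | zero => simpa using h
  | succ n ih =>
    intro i hi hi'
    push_cast at hi'
    rw [Function.iterate_succ_apply', covenF_eq_one_iff, ih i hi (by lia),
      ih (i + 1) (by lia) (by lia), ih (i + 2) (by lia) (by lia)]
    simp

theorem covenF_iterate_ne {x y : ℤ → Fin 2} {a b : ℤ} (hx : ∀ i, a ≤ i → i ≤ b → x i = 1)
    (hy : ∀ i, a ≤ i → i ≤ b → y i = 1) (hne : x (b + 1) ≠ y (b + 1)) (n : ℕ)
    (hn : a ≤ b + 1 - 2 * n) :
    covenF^[n] x (b + 1 - 2 * n) ≠ covenF^[n] y (b + 1 - 2 * n) := by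
  induction n with
  | zero => simpa using hne
  | succ n ih =>
    push_cast at hn
    specialize ih (by lia)
    have hx1 := covenF_iterate_eq_one hx n (b + 1 - 2 * n - 1) (by lia) (by lia)
    have hy1 := covenF_iterate_eq_one hy n (b + 1 - 2 * n - 1) (by lia) (by lia)
    have hx2 := covenF_iterate_eq_one hx n (b + 1 - 2 * n - 2) (by lia) (by lia)
    have hy2 := covenF_iterate_eq_one hy n (b + 1 - 2 * n - 2) (by lia) (by lia)
    rw [Function.iterate_succ_apply', Function.iterate_succ_apply',
      show b + 1 - 2 * ((n + 1 : ℕ) : ℤ) = b + 1 - 2 * n - 2 by push_cast; ring]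
    simp only [covenF]
    rw [show b + 1 - 2 * (n : ℤ) - 2 + 1 = b + 1 - 2 * n - 1 by ring, sub_add_cancel,
      hx1, hy1, hx2, hy2]
    clear hx1 hy1 hx2 hy2
    generalize covenF^[n] x (b + 1 - 2 * n) = u at *
    generalize covenF^[n] y (b + 1 - 2 * n) = v at *
    clear hn hne hx hy
    revert u v
    decide

theorem lamM_covenF {n : ℕ} (hn : 1 ≤ n) {x : ℤ → Fin 2} {q : ℤ}
    (hx : ∀ j : Fin (2 * n), x (q + ((j : ℕ) : ℤ)) = 1) : lamM univ covenF n x = 2 * n := by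
  have hub (z : ℤ → Fin 2) : lamTildeM univ covenF n z ≤ 2 * n :=
    Nat.sInf_le (mem_lamTildeM_covenF n z)
  refine le_antisymm (csSup_le (range_nonempty _) ?_) ?_
  · rintro _ ⟨j, rfl⟩
    exact hub _
  · refine le_trans ?_ (le_csSup ⟨2 * n, ?_⟩ (mem_range_self (q + 2 * n - 1)))
    · set z := shiftIter (q + 2 * n - 1) x with hz
      refine le_csInf ⟨_, mem_lamTildeM_covenF n z⟩ fun s hs => ?_
      have hz1 : ∀ i : ℤ, 1 - 2 * n ≤ i → i ≤ 0 → z i = 1 := by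
        intro i h1 h2
        have := hx ⟨(i + 2 * n - 1).toNat, by lia⟩
        rw [← this, hz, shiftIter]
        congr 1
        simp only
        lia
      have hyz : ∀ i : ℤ, i ≤ 0 → Function.update z 1 (z 1 + 1) i = z i := fun i hi =>
        Function.update_of_ne (by lia) _ _
      have hsub := (hs n hn le_rfl ⟨_, ⟨mem_univ _, hyz⟩, rfl⟩).2 (1 - 2 * n)
      have hne := covenF_iterate_ne (x := Function.update z 1 (z 1 + 1)) (y := z) (b := 0)
        (fun i h1 h2 => (hyz i h2).trans (hz1 i h1 h2)) hz1
        (by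
          rw [zero_add, Function.update_self]
          generalize z 1 = u
          revert u
          decide) n (by lia)
      rw [zero_add] at hne
      by_contra hlt
      exact hne (hsub (by lia))
    · rintro _ ⟨j, rfl⟩
      exact hub _

theorem measurableSet_constWord (c : Fin 2) (m : ℕ) (q : ℤ) :
    MeasurableSet {x : ℤ → Fin 2 | ∀ j : Fin m, x (q + ((j : ℕ) : ℤ)) = c} := by
  simp only [ofPred_forall]
  exact MeasurableSet.iInter fun j =>
    (measurable_pi_apply (X := fun _ : ℤ => Fin 2) (q + ((j : ℕ) : ℤ)))
      (measurableSet_singleton c)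

theorem ae_exists_constWord {μ : Measure (ℤ → Fin 2)} [IsProbabilityMeasure μ]
    (herg : Ergodic (shiftMap (Fin 2)) μ) (c : Fin 2) (m : ℕ) (a : ℤ)
    (hpos : μ {x : ℤ → Fin 2 | ∀ j : Fin m, x (a + ((j : ℕ) : ℤ)) = c} ≠ 0) :
    ∀ᵐ x ∂μ, ∃ q : ℤ, a ≤ q ∧ ∀ j : Fin m, x (q + ((j : ℕ) : ℤ)) = c := by
  set S : Set (ℤ → Fin 2) := {x | ∃ q : ℤ, a ≤ q ∧ ∀ j : Fin m, x (q + ((j : ℕ) : ℤ)) = c}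
    with hS
  have hmeas : MeasurableSet S := by
    rw [hS]
    simp only [ofPred_exists, ofPred_and]
    exact MeasurableSet.iUnion fun q =>
      (MeasurableSet.const _).inter (measurableSet_constWord c m q)
  have hsub : shiftMap (Fin 2) ⁻¹' S ⊆ S := by
    rintro x ⟨q, hq, h⟩
    refine ⟨q + 1, by lia, fun j => ?_⟩
    rw [← h j, shiftMap]
    congr 1
    ring
  rcases herg.ae_empty_or_univ_of_preimage_ae_le hmeas.nullMeasurableSet hsub.eventuallyLE
    with h | h
  · refine absurd (measure_mono_null ?_ (ae_eq_empty.1 h)) hpos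
    exact fun x hx => ⟨a, le_rfl, hx⟩
  · filter_upwards [h.mem_iff] with x hx
    exact hx.2 (mem_univ x)

theorem tendsto_measure_diff_preimage_zero {X : Type*} [TopologicalSpace X] [MeasurableSpace X]
    [BorelSpace X] {μ : Measure X} [IsFiniteMeasure μ] [μ.OuterRegular] {T : ℕ → X → X}
    (hT : ∀ n, MeasurePreserving (T n) μ μ)
    (hlim : ∀ᵐ x ∂μ, Tendsto (fun n => T n x) atTop (𝓝 x)) {s : Set X} (hs : MeasurableSet s) :
    Tendsto (fun n => μ (s \ T n ⁻¹' s)) atTop (𝓝 0) := by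
  rw [ENNReal.tendsto_nhds_zero]
  intro ε hε
  obtain ⟨U, hsU, hU, -, hUs⟩ := hs.exists_isOpen_sdiff_lt (measure_ne_top μ s)
    (ENNReal.half_pos hε.ne').ne'
  have hUm := hU.measurableSet
  have h0 : Tendsto (fun n => μ (U \ T n ⁻¹' U)) atTop (𝓝 (μ ∅)) := by
    refine tendsto_measure_of_ae_tendsto_indicator_of_isFiniteMeasure atTop MeasurableSet.empty
      (fun n => hUm.diff ((hT n).measurable hUm)) ?_
    filter_upwards [hlim] with x hx
    by_cases hxU : x ∈ U
    · filter_upwards [hx.eventually_mem (hU.mem_nhds hxU)] with n hn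
      simp [hn]
    · exact Eventually.of_forall fun n => by simp [hxU]
  rw [measure_empty, ENNReal.tendsto_nhds_zero] at h0
  filter_upwards [h0 (ε / 2) (ENNReal.half_pos hε.ne')] with n hn
  calc μ (s \ T n ⁻¹' s) ≤ μ ((U \ T n ⁻¹' U) ∪ T n ⁻¹' (U \ s)) := by
        refine measure_mono fun x hx => ?_
        by_cases h : T n x ∈ U
        · exact Or.inr ⟨h, hx.2⟩
        · exact Or.inl ⟨hsU hx.1, h⟩
    _ ≤ μ (U \ T n ⁻¹' U) + μ (T n ⁻¹' (U \ s)) := measure_union_le _ _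
    _ ≤ ε / 2 + ε / 2 := by
        rw [(hT n).measure_preimage (hUm.diff hs).nullMeasurableSet]
        exact add_le_add hn hUs.le
    _ = ε := ENNReal.add_halves ε

theorem negMulLog_sum_le {ι : Type*} (s : Finset ι) {p : ι → ℝ} (hp : ∀ i ∈ s, 0 ≤ p i) :
    Real.negMulLog (∑ i ∈ s, p i) ≤ ∑ i ∈ s, Real.negMulLog (p i) := by
  rw [Real.negMulLog, neg_mul, Finset.sum_mul, ← Finset.sum_neg_distrib]
  refine Finset.sum_le_sum fun i hi => ?_
  rw [Real.negMulLog, neg_mul, neg_le_neg_iff]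
  rcases (hp i hi).eq_or_lt with h | h
  · simp [← h]
  · exact mul_le_mul_of_nonneg_left (Real.log_le_log h (Finset.single_le_sum hp hi)) h.le

theorem negMulLog_le_of_marginals {p a b : ℝ} (hp : 0 ≤ p) (ha : p ≤ a) (hb : p ≤ b) :
    Real.negMulLog p ≤ -(p * Real.log a) - p * Real.log b + a * b - p := by
  rcases hp.eq_or_lt with h | h
  · subst h
    simpa using mul_nonneg ha hb
  · have ha' := h.trans_le ha
    have hb' := h.trans_le hb
    have hlog := Real.log_le_sub_one_of_pos (div_pos (mul_pos ha' hb') h)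
    rw [Real.log_div (mul_pos ha' hb').ne' h.ne', Real.log_mul ha'.ne' hb'.ne'] at hlog
    have := mul_le_mul_of_nonneg_left hlog hp
    rw [mul_sub p (a * b / p), mul_div_cancel₀ _ h.ne'] at this
    rw [Real.negMulLog]
    linarith

theorem sum_negMulLog_le_marginals {I J : Type*} [Fintype I] [Fintype J] {p : I × J → ℝ}
    (hp : ∀ k, 0 ≤ p k) (hsum : ∑ k, p k = 1) :
    ∑ k, Real.negMulLog (p k) ≤
      ∑ i, Real.negMulLog (∑ j, p (i, j)) + ∑ j, Real.negMulLog (∑ i, p (i, j)) := by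
  set a : I → ℝ := fun i => ∑ j, p (i, j) with ha
  set b : J → ℝ := fun j => ∑ i, p (i, j) with hb
  have hasum : ∑ i, a i = 1 := by rw [← hsum, Fintype.sum_prod_type]
  have hbsum : ∑ j, b j = 1 := by rw [← hsum, Fintype.sum_prod_type_right]
  calc ∑ k, Real.negMulLog (p k)
      ≤ ∑ k : I × J, (-(p k * Real.log (a k.1)) - p k * Real.log (b k.2) + a k.1 * b k.2 - p k) :=
        Finset.sum_le_sum fun k _ => negMulLog_le_of_marginals (hp k)
          (Finset.single_le_sum (f := fun j => p (k.1, j)) (fun j _ => hp _) (Finset.mem_univ k.2))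
          (Finset.single_le_sum (f := fun i => p (i, k.2)) (fun i _ => hp _) (Finset.mem_univ k.1))
    _ = ∑ k : I × J, -(p k * Real.log (a k.1)) + ∑ k : I × J, -(p k * Real.log (b k.2)) := by
        have hab : ∑ k : I × J, a k.1 * b k.2 = 1 := by
          rw [Fintype.sum_prod_type, ← Finset.sum_mul_sum, hasum, hbsum, one_mul]
        simp only [Finset.sum_sub_distrib, Finset.sum_add_distrib, Finset.sum_neg_distrib, hab,
          hsum]
        ring
    _ = ∑ i, Real.negMulLog (a i) + ∑ j, Real.negMulLog (b j) := by
        congr 1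
        · rw [Fintype.sum_prod_type]
          refine Finset.sum_congr rfl fun i _ => ?_
          rw [Real.negMulLog, neg_mul, ha, Finset.sum_mul, Finset.sum_neg_distrib]
        · rw [Fintype.sum_prod_type_right]
          refine Finset.sum_congr rfl fun j _ => ?_
          rw [Real.negMulLog, neg_mul, hb, Finset.sum_mul, Finset.sum_neg_distrib]

theorem partEnt_nonneg {Ω : Type*} [MeasurableSpace Ω] (μ : Measure Ω) [IsProbabilityMeasure μ]
    {I : Type*} [Fintype I] (α : Ω → I) : 0 ≤ partEnt μ α :=
  Finset.sum_nonneg fun _ _ =>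
    Real.negMulLog_nonneg ENNReal.toReal_nonneg (measureReal_le_one (μ := μ))

theorem partEnt_comp_measurePreserving {Ω : Type*} [MeasurableSpace Ω] {μ : Measure Ω}
    {I : Type*} [Fintype I] [MeasurableSpace I] [MeasurableSingletonClass I] {S : Ω → Ω} (hS : MeasurePreserving S μ μ)
    {α : Ω → I} (hα : Measurable α) : partEnt μ (fun x => α (S x)) = partEnt μ α := by
  refine Finset.sum_congr rfl fun i _ => ?_
  rw [← hS.measure_preimage (hα (measurableSet_singleton i)).nullMeasurableSet]
  rfl

section Entropy

variable {Ω : Type*} [MeasurableSpace Ω] {μ : Measure Ω} [IsProbabilityMeasure μ]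
  {I J : Type*} [Fintype I] [Fintype J] [MeasurableSpace I] [MeasurableSpace J]
  [MeasurableSingletonClass I] [MeasurableSingletonClass J]

theorem partEnt_comp_le {K : Type*} [Fintype K] {α : Ω → I} (hα : Measurable α) (g : I → K) :
    partEnt μ (fun x => g (α x)) ≤ partEnt μ α := by
  classical
  have hfib (k : K) : (μ ((fun x => g (α x)) ⁻¹' {k})).toReal =
      ∑ i with g i = k, (μ (α ⁻¹' {i})).toReal := by
    have h := sum_measureReal_preimage_singleton (μ := μ) ({i | g i = k} : Finset I) (f := α)
      (fun i _ => hα (measurableSet_singleton i))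
    simp only [Measure.real] at h
    rw [h]
    congr 2
    ext x
    simp
  unfold partEnt
  rw [← Finset.sum_fiberwise Finset.univ g fun i => Real.negMulLog (μ (α ⁻¹' {i})).toReal]
  refine Finset.sum_le_sum fun k _ => ?_
  rw [hfib]
  exact negMulLog_sum_le _ fun _ _ => ENNReal.toReal_nonneg

theorem partEnt_prod_le {α : Ω → I} {β : Ω → J} (hα : Measurable α) (hβ : Measurable β) :
    partEnt μ (fun x => (α x, β x)) ≤ partEnt μ α + partEnt μ β := by
  set p : I × J → ℝ := fun k => (μ ((fun x => (α x, β x)) ⁻¹' {k})).toReal with hp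
  have hmeas (k : I × J) : MeasurableSet ((fun x => (α x, β x)) ⁻¹' {k}) :=
    (hα.prodMk hβ) (measurableSet_singleton k)
  have hsum : ∑ k, p k = 1 := by
    have h := sum_measureReal_preimage_singleton (μ := μ) Finset.univ
      (f := fun x => (α x, β x)) (fun k _ => hmeas k)
    simpa [Measure.real] using h
  have hleft (i : I) : ∑ j, p (i, j) = (μ (α ⁻¹' {i})).toReal := by
    have h := sum_measureReal_preimage_singleton (μ := μ.restrict (α ⁻¹' {i})) Finset.univ
      (f := β) (fun j _ => hβ (measurableSet_singleton j))
    simp only [Measure.real, Finset.coe_univ, preimage_univ, Measure.restrict_apply_univ] at h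
    rw [← h]
    refine Finset.sum_congr rfl fun j _ => ?_
    simp only [hp, Measure.restrict_apply (hβ (measurableSet_singleton j))]
    congr 2
    ext x
    simp [and_comm]
  have hright (j : J) : ∑ i, p (i, j) = (μ (β ⁻¹' {j})).toReal := by
    have h := sum_measureReal_preimage_singleton (μ := μ.restrict (β ⁻¹' {j})) Finset.univ
      (f := α) (fun i _ => hα (measurableSet_singleton i))
    simp only [Measure.real, Finset.coe_univ, preimage_univ, Measure.restrict_apply_univ] at h
    rw [← h]
    refine Finset.sum_congr rfl fun i _ => ?_
    simp only [hp, Measure.restrict_apply (hα (measurableSet_singleton i))]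
    congr 2
    ext x
    simp
  have h := sum_negMulLog_le_marginals (p := p) (fun _ => ENNReal.toReal_nonneg) hsum
  simp only [hleft, hright] at h
  exact h

end Entropy

section Rigid

variable {Ω : Type*} [MeasurableSpace Ω] {μ : Measure Ω} [IsProbabilityMeasure μ] {T : Ω → Ω}
  {k : ℕ} {α : Ω → Fin k}

theorem measurable_itinerary (hT : Measurable T) (hα : Measurable α) (n : ℕ) :
    Measurable fun x (i : Fin n) => α (T^[(i : ℕ)] x) :=
  measurable_pi_lambda _ fun i => hα.comp (hT.iterate i)

theorem partEnt_itinerary_le [NeZero k] (hT : MeasurePreserving T μ μ) (hα : Measurable α)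
    {n : ℕ} (hn : 0 < n) (N : ℕ) :
    partEnt μ (fun x (i : Fin N) => α (T^[(i : ℕ)] x)) ≤
      partEnt μ (fun x (i : Fin n) => α (T^[(i : ℕ)] x)) +
        N * partEnt μ (fun x => α (T^[n] x) - α x) := by
  set δ : Ω → Fin k := fun x => α (T^[n] x) - α x with hδ
  have hδm : Measurable δ :=
    (Measurable.of_discrete (f := fun z : Fin k × Fin k => z.1 - z.2)).comp
      ((hα.comp (hT.measurable.iterate n)).prodMk hα)
  rcases le_or_gt N n with hN | hN
  · refine le_add_of_le_of_nonneg ?_ (mul_nonneg N.cast_nonneg (partEnt_nonneg μ δ))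
    exact partEnt_comp_le (measurable_itinerary hT.measurable hα n)
      fun u (i : Fin N) => u (Fin.castLE hN i)
  · induction N, hN.le using Nat.le_induction with
    | base => exact absurd hN (lt_irrefl n)
    | succ N hnN ih =>
      obtain ⟨g, hg⟩ : ∃ g : (Fin N → Fin k) × Fin k → Fin (N + 1) → Fin k,
          (fun x (i : Fin (N + 1)) => α (T^[(i : ℕ)] x)) =
            fun x => g (fun i : Fin N => α (T^[(i : ℕ)] x), δ (T^[N - n] x)) := by
        refine ⟨fun z i => if h : (i : ℕ) < N then z.1 ⟨i, h⟩ else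
          if h' : N - n < N then z.1 ⟨N - n, h'⟩ + z.2 else z.2, ?_⟩
        funext x i
        by_cases h : (i : ℕ) < N
        · simp [h]
        · have hi : (i : ℕ) = n + (N - n) := by have := i.isLt; lia
          have h' : N - n < N := by lia
          simp only [h, h', dite_true, dite_false, hδ]
          rw [hi, Function.iterate_add_apply]
          exact (add_sub_cancel _ _).symm
      have hm := measurable_itinerary (k := k) hT.measurable hα N
      have hδN : Measurable fun x => δ (T^[N - n] x) := hδm.comp (hT.measurable.iterate _)
      have hprev : partEnt μ (fun x (i : Fin N) => α (T^[(i : ℕ)] x)) ≤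
          partEnt μ (fun x (i : Fin n) => α (T^[(i : ℕ)] x)) + N * partEnt μ δ := by
        rcases hnN.eq_or_lt with rfl | h
        · exact le_add_of_nonneg_right (mul_nonneg (Nat.cast_nonneg _) (partEnt_nonneg μ δ))
        · exact ih h
      rw [hg]
      refine (partEnt_comp_le (hm.prodMk hδN) g).trans ((partEnt_prod_le hm hδN).trans ?_)
      rw [partEnt_comp_measurePreserving (hT.iterate _) hδm]
      push_cast
      linarith

theorem entropyPart_nonneg (μ : Measure Ω) [IsProbabilityMeasure μ] (T : Ω → Ω)
    (α : Ω → Fin k) : 0 ≤ entropyPart μ T α :=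
  Real.iInf_nonneg fun n => div_nonneg (partEnt_nonneg μ _) (by positivity)

theorem entropyPart_le_partEnt_sub [NeZero k] (hT : MeasurePreserving T μ μ) (hα : Measurable α)
    {n : ℕ} (hn : 0 < n) :
    entropyPart μ T α ≤ partEnt μ (fun x => α (T^[n] x) - α x) := by
  set H := partEnt μ (fun x (i : Fin n) => α (T^[(i : ℕ)] x))
  set D := partEnt μ (fun x => α (T^[n] x) - α x)
  have hlim : Tendsto (fun N : ℕ => H * (1 / ((N : ℝ) + 1)) + D) atTop (𝓝 D) := by
    simpa using (tendsto_one_div_add_atTop_nhds_zero_nat.const_mul H).add_const D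
  refine ge_of_tendsto' hlim fun N => ?_
  have hbdd : BddBelow (range fun n : ℕ =>
      partEnt μ (fun x (i : Fin (n + 1)) => α (T^[(i : ℕ)] x)) / ((n : ℝ) + 1)) :=
    ⟨0, by rintro _ ⟨n, rfl⟩; exact div_nonneg (partEnt_nonneg μ _) (by positivity)⟩
  refine (ciInf_le hbdd N).trans ?_
  have hN : (0 : ℝ) < N + 1 := by positivity
  rw [div_le_iff₀ hN]
  have h := partEnt_itinerary_le hT hα hn (N + 1)
  push_cast at h
  calc _ ≤ H + (N + 1) * D := h
    _ = _ := by field_simp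

theorem entropyPart_eq_zero_of_rigid [TopologicalSpace Ω] [BorelSpace Ω] [μ.OuterRegular]
    (hT : MeasurePreserving T μ μ) {n : ℕ → ℕ} (hn : ∀ l, 0 < n l)
    (hlim : ∀ᵐ x ∂μ, Tendsto (fun l => T^[n l] x) atTop (𝓝 x)) (hα : Measurable α) :
    entropyPart μ T α = 0 := by
  have hΩ : Nonempty Ω := nonempty_of_isProbabilityMeasure μ
  have : NeZero k := ⟨by
    rintro rfl
    exact (α hΩ.some).elim0⟩
  refine le_antisymm ?_ (entropyPart_nonneg μ T α)
  have hdiff : Tendsto (fun l => μ {x | α (T^[n l] x) ≠ α x}) atTop (𝓝 0) := by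
    have h : Tendsto (fun l => ∑ a : Fin k, μ ((α ⁻¹' {a}) \ T^[n l] ⁻¹' (α ⁻¹' {a}))) atTop
        (𝓝 (∑ _a : Fin k, 0)) :=
      tendsto_finsetSum _ fun a _ => tendsto_measure_diff_preimage_zero
        (fun l => hT.iterate (n l)) hlim (hα (measurableSet_singleton a))
    rw [Finset.sum_const_zero] at h
    refine tendsto_of_tendsto_of_tendsto_of_le_of_le tendsto_const_nhds h (fun _ => zero_le)
      fun l => (measure_mono fun x hx => ?_).trans (measure_biUnion_finset_le Finset.univ _)
    exact mem_biUnion (Finset.mem_univ (α x)) ⟨rfl, hx⟩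
  have hmeas (l : ℕ) : MeasurableSet {x | α (T^[n l] x) ≠ α x} :=
    (measurableSet_eq_fun (hα.comp (hT.measurable.iterate _)) hα).compl
  have hent : Tendsto (fun l => partEnt μ (fun x => α (T^[n l] x) - α x)) atTop
      (𝓝 (∑ _d : Fin k, 0)) := by
    refine tendsto_finsetSum _ fun d _ => ?_
    by_cases hd : d = 0
    · subst hd
      have h1 : Tendsto (fun l => μ ((fun x => α (T^[n l] x) - α x) ⁻¹' {0})) atTop (𝓝 1) := by
        have h := ENNReal.Tendsto.sub (tendsto_const_nhds (x := (1 : ENNReal))) hdiff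
          (Or.inl ENNReal.one_ne_top)
        rw [tsub_zero] at h
        refine h.congr fun l => ?_
        rw [← prob_compl_eq_one_sub (hmeas l)]
        congr 1
        ext x
        simp [sub_eq_zero]
      have h2 := (Real.continuous_negMulLog.tendsto _).comp
        ((ENNReal.tendsto_toReal ENNReal.one_ne_top).comp h1)
      simpa [Function.comp_def] using h2
    · have h1 : Tendsto (fun l => μ ((fun x => α (T^[n l] x) - α x) ⁻¹' {d})) atTop (𝓝 0) := by
        refine tendsto_of_tendsto_of_tendsto_of_le_of_le tendsto_const_nhds hdiff
          (fun _ => zero_le) fun l => measure_mono fun x hx => ?_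
        intro hx'
        refine hd ?_
        rw [← show α (T^[n l] x) - α x = d from hx, hx', sub_self]
      have h2 := (Real.continuous_negMulLog.tendsto _).comp
        ((ENNReal.tendsto_toReal ENNReal.zero_ne_top).comp h1)
      simpa [Function.comp_def] using h2
  rw [Finset.sum_const_zero] at hent
  exact ge_of_tendsto' hent fun l => entropyPart_le_partEnt_sub hT hα (hn l)

theorem metricEntropy_eq_zero_of_rigid [TopologicalSpace Ω] [BorelSpace Ω] [μ.OuterRegular]
    (hT : MeasurePreserving T μ μ) {n : ℕ → ℕ} (hn : ∀ l, 0 < n l)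
    (hlim : ∀ᵐ x ∂μ, Tendsto (fun l => T^[n l] x) atTop (𝓝 x)) : metricEntropy μ T = 0 := by
  unfold metricEntropy
  simp [fun p : {q : Σ k : ℕ, Ω → Fin k // Measurable q.2} =>
    entropyPart_eq_zero_of_rigid hT hn hlim p.2]

end Rigid

theorem tendsto_covenF_iterate_two_pow {x : ℤ → Fin 2}
    (hx : ∀ i : ℤ, ∃ q : ℤ, i ≤ q ∧ ∀ j : Fin 3, x (q + ((j : ℕ) : ℤ)) = 0) :
    Tendsto (fun l : ℕ => covenF^[2 ^ l] x) atTop (𝓝 x) := by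
  rw [tendsto_pi_nhds]
  intro i
  obtain ⟨q, hiq, hq⟩ := hx i
  refine tendsto_const_nhds.congr' ?_
  filter_upwards [eventually_ge_atTop (q - i).toNat] with l hl
  have h := covenF_iterate_add_two_pow hq l i (by lia) (by lia) 0
  simpa using h.symm

theorem tendsto_integral_Iminus_covenF {μ : Measure (ℤ → Fin 2)} [IsProbabilityMeasure μ]
    (h : ∀ᵐ x ∂μ, ∃ q : ℤ, 0 ≤ q ∧ ∀ j : Fin 3, x (q + ((j : ℕ) : ℤ)) = 0) :
    Tendsto (fun n : ℕ => (∫ x, (Iminus univ covenF n x : ℝ) ∂μ) / n) atTop (𝓝 0) := by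
  set B : ℕ → Set (ℤ → Fin 2) := fun N =>
    ⋂ q ∈ Finset.range N, {x | ∀ j : Fin 3, x ((q : ℤ) + ((j : ℕ) : ℤ)) = 0}ᶜ with hB
  have hBm (N : ℕ) : MeasurableSet (B N) :=
    Finset.measurableSet_biInter _ fun q _ => (measurableSet_constWord 0 3 q).compl
  have hBanti : Antitone B := fun M N hMN =>
    biInter_subset_biInter_left fun q hq => Finset.range_mono hMN hq
  have hB0 : Tendsto (fun N => μ.real (B N)) atTop (𝓝 0) := by
    have hlim := tendsto_measure_iInter_atTop (fun N => (hBm N).nullMeasurableSet) hBanti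
      ⟨0, measure_ne_top μ _⟩
    have hnull : μ (⋂ N, B N) = 0 := by
      refine measure_mono_null (fun x hx => ?_) (ae_iff.1 h)
      rintro ⟨q, hq0, hq⟩
      lift q to ℕ using hq0
      exact mem_iInter₂.1 (mem_iInter.1 hx (q + 1)) q (Finset.self_mem_range_succ q) hq
    rw [hnull] at hlim
    exact (ENNReal.tendsto_toReal ENNReal.zero_ne_top).comp hlim
  have hbound (N n : ℕ) : ∫ x, (Iminus univ covenF n x : ℝ) ∂μ ≤
      (N + 2) + 2 * n * μ.real (B N) := by
    have hint : Integrable ((B N).indicator fun _ => (2 * n : ℝ)) μ :=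
      (integrable_const _).indicator (hBm N)
    calc ∫ x, (Iminus univ covenF n x : ℝ) ∂μ
        ≤ ∫ x, ((N + 2 : ℝ) + (B N).indicator (fun _ => (2 * n : ℝ)) x) ∂μ := by
          refine integral_mono_of_nonneg (ae_of_all _ fun x => Nat.cast_nonneg _)
            ((integrable_const _).add hint) (ae_of_all _ fun x => ?_)
          by_cases hx : x ∈ B N
          · have h1 : (Iminus univ covenF n x : ℝ) ≤ 2 * n := by
              exact_mod_cast Iminus_covenF_le_two_mul n x
            simp only [indicator_of_mem hx]
            linarith [N.cast_nonneg (α := ℝ)]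
          · simp only [hB, mem_iInter, mem_compl_iff, not_forall, not_not] at hx
            obtain ⟨q, hqN, hq⟩ := hx
            have hqN := Finset.mem_range.1 hqN
            have h1 : (Iminus univ covenF n x : ℝ) ≤ N + 2 := by
              exact_mod_cast (Iminus_covenF_le_of_zeros n hq).trans (by lia)
            have h2 : 0 ≤ (B N).indicator (fun _ => (2 * n : ℝ)) x :=
              indicator_nonneg (fun _ _ => by positivity) x
            simp only
            linarith
      _ = (N + 2) + 2 * n * μ.real (B N) := by
          rw [integral_add (integrable_const _) hint, integral_indicator_const _ (hBm N)]
          simp [mul_comm]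
  refine tendsto_order.2 ⟨fun a ha => Eventually.of_forall fun n => ha.trans_le ?_, fun a ha => ?_⟩
  · exact div_nonneg (integral_nonneg fun x => Nat.cast_nonneg _) n.cast_nonneg
  · obtain ⟨N, hN⟩ := ((tendsto_order.1 hB0).2 (a / 4) (by positivity)).exists
    have h1 : Tendsto (fun n : ℕ => ((N : ℝ) + 2) / n) atTop (𝓝 0) :=
      tendsto_const_div_atTop_nhds_zero_nat _
    filter_upwards [(tendsto_order.1 h1).2 (a / 2) (by positivity), eventually_gt_atTop 0]
      with n hn hn0
    have hn0' : (0 : ℝ) < n := by exact_mod_cast hn0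
    rw [div_lt_iff₀ hn0'] at hn ⊢
    nlinarith [hbound N n, mul_lt_mul_of_pos_left hN hn0']

/-- For the Coven automaton and the uniform measure `μ` on `{0,1}^ℤ`:
`λ_μ⁺ = 0`, `λ_μ⁻ = 2`, `I_μ⁺ + I_μ⁻ = 0` and `h_μ(F) = 0`. -/
theorem stmt17 (μ : Measure (ℤ → Fin 2)) [IsProbabilityMeasure μ]
    (hμu : ∀ (t : ℤ) (k : ℕ) (u : Fin k → Fin 2),
      μ {x : ℤ → Fin 2 | ∀ j : Fin k, x (t + ((j : ℕ) : ℤ)) = u j} =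
        ((2 : ENNReal))⁻¹ ^ k)
    (herg : Ergodic (shiftMap (Fin 2)) μ)
    (hFinv : MeasurePreserving covenF μ μ)
    (lp lm : ℝ)
    (hlp : ∀ᵐ x ∂μ, Filter.Tendsto
      (fun n : ℕ => (lamP (Set.univ) covenF n x : ℝ) / n) Filter.atTop (nhds lp))
    (hlm : ∀ᵐ x ∂μ, Filter.Tendsto
      (fun n : ℕ => (lamM (Set.univ) covenF n x : ℝ) / n) Filter.atTop (nhds lm)) :
    lp = 0 ∧ lm = 2 ∧
    avgIplus (Set.univ) covenF μ + avgIminus (Set.univ) covenF μ = 0 ∧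
    metricEntropy μ covenF = 0 := by
  have hword (c : Fin 2) (m : ℕ) (t : ℤ) :
      ∀ᵐ x ∂μ, ∃ q : ℤ, t ≤ q ∧ ∀ j : Fin m, x (q + ((j : ℕ) : ℤ)) = c :=
    ae_exists_constWord herg c m t (by
      rw [hμu t m fun _ => c]
      exact pow_ne_zero _ (by simp))
  refine ⟨?_, ?_, ?_, ?_⟩
  · obtain ⟨x, hx⟩ := hlp.exists
    simp only [lamP_covenF, Nat.cast_zero, zero_div] at hx
    exact tendsto_nhds_unique hx tendsto_const_nhds
  · obtain ⟨x, hx, hones⟩ := (hlm.and (ae_all_iff.2 fun n : ℕ => hword 1 (2 * n) 0)).exists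
    refine tendsto_nhds_unique hx (tendsto_const_nhds.congr' ?_)
    filter_upwards [eventually_ge_atTop 1] with n hn
    obtain ⟨q, -, hq⟩ := hones n
    have hn' : (n : ℝ) ≠ 0 := by exact_mod_cast (show n ≠ 0 by lia)
    rw [lamM_covenF hn hq, Nat.cast_mul, Nat.cast_two, mul_div_cancel_right₀ _ hn']
  · have h1 : avgIplus univ covenF μ = 0 := by
      simp [avgIplus, Iplus_covenF]
    have h2 : avgIminus univ covenF μ = 0 :=
      (tendsto_integral_Iminus_covenF (hword 0 3 0)).liminf_eq
    rw [h1, h2, add_zero]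
  · refine metricEntropy_eq_zero_of_rigid hFinv (n := fun l => 2 ^ l)
      (fun l => Nat.two_pow_pos l) ?_
    filter_upwards [ae_all_iff.2 fun i : ℤ => hword 0 3 i] with x hx
    exact tendsto_covenF_iterate_two_pow hx
end
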